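/- For every complete multipartite graph K_{r_1,…,r_k} with k ≥ 3 parts, every part of size at least 2 (r_k ≥ 2), r_j = 3 for some j ∈ {1,…,k}, and whose total number of vertices n = r_1 + … + r_k is even, the game chromatic number satisfies χ_g(K_{r_1,…,r_k}) ≥ 2k − 2. -/

import Mathlib

/-- A color `c` is legal for vertex `v` in partial coloring `f` if no neighbor of `v`
is already colored with `c`. -/
def legalColor {V C : Type} (G : SimpleGraph V) (f : V → Option C) (v : V) (c : C) : Prop :=
  ∀ w, G.Adj v w → f w ≠ some c

/-- A move in the coloring game: choose an uncolored vertex and color it with a legal color. -/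
def gameMove {V C : Type} [DecidableEq V] (G : SimpleGraph V) (f f' : V → Option C) : Prop :=
  ∃ v c, f v = none ∧ legalColor G f v c ∧ f' = Function.update f v (some c)

/-- Every vertex is colored. -/
def isFull {V C : Type} (f : V → Option C) : Prop := ∀ v, (f v).isSome

/-- Some uncolored vertex has no legal color (then Bob wins). -/
def isStuck {V C : Type} (G : SimpleGraph V) (f : V → Option C) : Prop :=
  ∃ v, f v = none ∧ ∀ c, ¬ legalColor G f v c

/-- It is Alice's turn when an even number of vertices are colored
(Alice moves first, and each move colors exactly one vertex). -/
def aliceTurn {V C : Type} [Fintype V] (f : V → Option C) : Prop :=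
  Even (Finset.univ.filter (fun v => (f v).isSome = true)).card

/-- Alice has a winning strategy from position `f` when `n` vertices remain uncolored:
Alice wins exactly the plays in which the entire graph gets colored; as soon as some
uncolored vertex has no legal color, Bob wins. -/
def aliceWinsFrom {V C : Type} [Fintype V] [DecidableEq V] (G : SimpleGraph V) :
    ℕ → (V → Option C) → Prop
  | 0, f => isFull f
  | n + 1, f => isFull f ∨ (¬ isStuck G f ∧
      ((aliceTurn f ∧ ∃ f', gameMove G f f' ∧ aliceWinsFrom G n f') ∨
       (¬ aliceTurn f ∧ ∀ f', gameMove G f f' → aliceWinsFrom G n f')))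

/-- Alice has a winning strategy in the graph coloring game on `G` with `m` colors. -/
def aliceWins {V : Type} [Fintype V] [DecidableEq V] (G : SimpleGraph V) (m : ℕ) : Prop :=
  aliceWinsFrom (C := Fin m) G (Fintype.card V) (fun _ => none)

/-- The game chromatic number: the least number of colors for which Alice has
a winning strategy. -/
noncomputable def gameChromaticNumber {V : Type} [Fintype V] [DecidableEq V]
    (G : SimpleGraph V) : ℕ :=
  sInf {m | aliceWins G m}

/-- The complete multipartite graph `K_{r 0, …, r (k-1)}`. -/
def K (k : ℕ) (r : Fin k → ℕ) : SimpleGraph (Σ i : Fin k, Fin (r i)) :=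
  SimpleGraph.completeMultipartiteGraph (fun i => Fin (r i))

section Counting

variable {k m : ℕ} {r : Fin k → ℕ}

/-- The parts of which no vertex is colored. -/
def untouchedParts (f : (Σ i : Fin k, Fin (r i)) → Option (Fin m)) : Finset (Fin k) :=
  Finset.univ.filter (fun i => ∀ x, f ⟨i, x⟩ = none)

/-- The colors that have not been used. -/
def freeColors (f : (Σ i : Fin k, Fin (r i)) → Option (Fin m)) : Finset (Fin m) :=
  Finset.univ.filter (fun c => ∀ w, f w ≠ some c)

/-- The uncolored vertices lying in parts that contain a colored vertex. -/
def vacantVertices (f : (Σ i : Fin k, Fin (r i)) → Option (Fin m)) :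
    Finset (Σ i : Fin k, Fin (r i)) :=
  Finset.univ.filter (fun w => f w = none ∧ w.1 ∉ untouchedParts f)

/-- The uncolored vertices. -/
def uncolored {V C : Type} [Fintype V] [DecidableEq C] (f : V → Option C) : Finset V :=
  Finset.univ.filter (fun w => f w = none)

theorem card_uncolored_update {V C : Type} [Fintype V] [DecidableEq V] [DecidableEq C]
    {f : V → Option C} {v : V} (hv : f v = none) (c : C) :
    (uncolored (Function.update f v (some c))).card + 1 = (uncolored f).card := by
  have h : uncolored (Function.update f v (some c)) = (uncolored f).erase v := by
    ext w
    by_cases hw : w = v <;> simp [uncolored, hw, Function.update_apply]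
  rw [h, Finset.card_erase_add_one]
  simp [uncolored, hv]

theorem aliceTurn_iff_even_uncolored {V C : Type} [Fintype V] [DecidableEq C]
    (hV : Even (Fintype.card V)) (f : V → Option C) :
    aliceTurn f ↔ Even (uncolored f).card := by
  have h := Finset.card_filter_add_card_filter_not (s := (Finset.univ : Finset V))
    (fun v => (f v).isSome = true)
  have h' : Finset.univ.filter (fun v => ¬ (f v).isSome = true) = uncolored f := by
    ext w
    simp [uncolored]
  rw [h', Finset.card_univ] at h
  rw [← h, Nat.even_add] at hV
  exact hV

theorem card_uncolored (f : (Σ i : Fin k, Fin (r i)) → Option (Fin m)) :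
    (uncolored f).card = (vacantVertices f).card + ∑ i ∈ untouchedParts f, r i := by
  have h : uncolored f =
      vacantVertices f ∪ (untouchedParts f).sigma (fun _ => Finset.univ) := by
    ext ⟨i, x⟩
    by_cases hi : i ∈ untouchedParts f
    · have := (Finset.mem_filter.1 hi).2 x
      simp [uncolored, vacantVertices, hi, this]
    · simp [uncolored, vacantVertices, hi]
  rw [h, Finset.card_union_of_disjoint]
  · simp
  · rw [Finset.disjoint_left]
    rintro ⟨i, x⟩ h1 h2
    exact (Finset.mem_filter.1 h1).2.2 (Finset.mem_sigma.1 h2).1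

theorem untouchedParts_update (f : (Σ i : Fin k, Fin (r i)) → Option (Fin m))
    (v : Σ i : Fin k, Fin (r i)) (c : Fin m) :
    untouchedParts (Function.update f v (some c)) = (untouchedParts f).erase v.1 := by
  obtain ⟨i, x⟩ := v
  ext j
  simp only [untouchedParts, Finset.mem_filter, Finset.mem_univ, true_and, Finset.mem_erase]
  constructor
  · intro h
    have hj : j ≠ i := by
      rintro rfl
      simpa using h x
    refine ⟨hj, fun y => ?_⟩
    have hne : (⟨j, y⟩ : Σ i : Fin k, Fin (r i)) ≠ ⟨i, x⟩ := fun e => hj (congrArg Sigma.fst e)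
    simpa [Function.update_of_ne hne] using h y
  · rintro ⟨hj, h⟩ y
    have hne : (⟨j, y⟩ : Σ i : Fin k, Fin (r i)) ≠ ⟨i, x⟩ := fun e => hj (congrArg Sigma.fst e)
    rw [Function.update_of_ne hne]
    exact h y

theorem freeColors_update {f : (Σ i : Fin k, Fin (r i)) → Option (Fin m)}
    {v : Σ i : Fin k, Fin (r i)} (hv : f v = none) (c : Fin m) :
    freeColors (Function.update f v (some c)) = (freeColors f).erase c := by
  ext d
  simp only [freeColors, Finset.mem_filter, Finset.mem_univ, true_and, Finset.mem_erase]
  constructor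
  · intro h
    refine ⟨fun e => h v (by simp [e]), fun w hw => ?_⟩
    have hne : w ≠ v := by
      rintro rfl
      simp [hv] at hw
    exact h w (by rwa [Function.update_of_ne hne])
  · rintro ⟨hd, h⟩ w
    by_cases hw : w = v
    · subst hw
      simpa using Ne.symm hd
    · rw [Function.update_of_ne hw]
      exact h w

theorem card_vacantVertices_update_of_mem {f : (Σ i : Fin k, Fin (r i)) → Option (Fin m)}
    {v : Σ i : Fin k, Fin (r i)} (hv : f v = none) (hU : v.1 ∈ untouchedParts f) (c : Fin m) :
    (vacantVertices (Function.update f v (some c))).card + 1 =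
      (vacantVertices f).card + r v.1 := by
  have h1 := card_uncolored f
  have h2 := card_uncolored (Function.update f v (some c))
  have h3 := card_uncolored_update hv c
  rw [untouchedParts_update] at h2
  have h4 := Finset.add_sum_erase _ r hU
  omega

theorem card_vacantVertices_update_of_notMem {f : (Σ i : Fin k, Fin (r i)) → Option (Fin m)}
    {v : Σ i : Fin k, Fin (r i)} (hv : f v = none) (hU : v.1 ∉ untouchedParts f) (c : Fin m) :
    (vacantVertices (Function.update f v (some c))).card + 1 = (vacantVertices f).card := by
  have h1 := card_uncolored f
  have h2 := card_uncolored (Function.update f v (some c))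
  have h3 := card_uncolored_update hv c
  rw [untouchedParts_update, Finset.erase_eq_of_notMem hU] at h2
  omega

theorem legalColor_of_mem_freeColors {f : (Σ i : Fin k, Fin (r i)) → Option (Fin m)} {c : Fin m}
    (hc : c ∈ freeColors f) (v : Σ i : Fin k, Fin (r i)) : legalColor (K k r) f v c :=
  fun w _ => (Finset.mem_filter.1 hc).2 w

theorem mem_freeColors_of_legalColor {f : (Σ i : Fin k, Fin (r i)) → Option (Fin m)} {c : Fin m}
    {v : Σ i : Fin k, Fin (r i)} (hU : v.1 ∈ untouchedParts f)
    (hc : legalColor (K k r) f v c) : c ∈ freeColors f := by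
  refine Finset.mem_filter.2 ⟨Finset.mem_univ _, fun w hw => ?_⟩
  by_cases h : v.1 = w.1
  · obtain ⟨j, y⟩ := w
    have := (Finset.mem_filter.1 hU).2
    obtain ⟨i, x⟩ := v
    obtain rfl : i = j := h
    simp [this y] at hw
  · exact hc w (by simpa [K] using h) hw

/-- If Alice wins although some part is untouched, then an unused color is left and
the game goes on. -/
theorem aliceWinsFrom_of_untouched (h2 : ∀ j, 2 ≤ r j) {n : ℕ}
    {f : (Σ i : Fin k, Fin (r i)) → Option (Fin m)} (hU : 0 < (untouchedParts f).card)
    (hf : aliceWinsFrom (K k r) n f) :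
    0 < (freeColors f).card ∧ ∃ n', n = n' + 1 ∧
      ((aliceTurn f ∧ ∃ f', gameMove (K k r) f f' ∧ aliceWinsFrom (K k r) n' f') ∨
       (¬ aliceTurn f ∧ ∀ f', gameMove (K k r) f f' → aliceWinsFrom (K k r) n' f')) := by
  obtain ⟨i, hi⟩ := Finset.card_pos.1 hU
  have hx := (Finset.mem_filter.1 hi).2 ⟨0, by have := h2 i; omega⟩
  have hfull : ¬ isFull f := fun h => by simpa [hx] using h ⟨i, ⟨0, by have := h2 i; omega⟩⟩
  cases n with
  | zero => exact absurd hf hfull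
  | succ n =>
    rcases hf with hf | ⟨hs, hf⟩
    · exact absurd hf hfull
    · refine ⟨?_, n, rfl, hf⟩
      by_contra h0
      refine hs ⟨_, hx, fun c hc => h0 (Finset.card_pos.2 ⟨c, ?_⟩)⟩
      exact mem_freeColors_of_legalColor hi hc

/-- Bob's winning positions: Alice is to move, and, with `u` untouched parts, `c` free colors and
`v` vacant vertices in touched parts, `c + 3 ≤ 2 * u`, or `c + 2 ≤ 2 * u` and `2 ≤ v`. -/
theorem not_aliceWinsFrom (h2 : ∀ j, 2 ≤ r j) (heven : Even (∑ i, r i)) (n : ℕ) :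
    ∀ f : (Σ i : Fin k, Fin (r i)) → Option (Fin m), aliceTurn f →
      ((freeColors f).card + 3 ≤ 2 * (untouchedParts f).card ∨
        2 ≤ (vacantVertices f).card ∧
          (freeColors f).card + 2 ≤ 2 * (untouchedParts f).card) →
      ¬ aliceWinsFrom (K k r) n f := by
  have hV : Even (Fintype.card (Σ i : Fin k, Fin (r i))) := by simpa using heven
  induction n using Nat.strong_induction_on with
  | _ n ih =>
    intro f hturn hinv hwin
    obtain ⟨hc, n, rfl, hmove⟩ := aliceWinsFrom_of_untouched h2 (by omega) hwin
    rcases hmove with ⟨-, g, ⟨v, c, hv, hlegal, rfl⟩, hg⟩ | ⟨h, -⟩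
    swap
    · exact h hturn
    set g := Function.update f v (some c) with hgdef
    have hunc : (uncolored g).card + 1 = (uncolored f).card := card_uncolored_update hv c
    have hUg : untouchedParts g = (untouchedParts f).erase v.1 := untouchedParts_update f v c
    have hFg : freeColors g = (freeColors f).erase c := freeColors_update hv c
    rw [aliceTurn_iff_even_uncolored hV] at hturn
    have hgturn : ¬ aliceTurn g := by
      rw [aliceTurn_iff_even_uncolored hV]
      rw [← hunc, Nat.even_add_one] at hturn
      exact hturn
    have hUle : (untouchedParts f).card ≤ (untouchedParts g).card + 1 := by
      rw [hUg]
      exact Nat.le_add_of_sub_le (Finset.pred_card_le_card_erase)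
    obtain ⟨hcg, n, rfl, hmove⟩ := aliceWinsFrom_of_untouched h2 (by omega) hg
    rcases hmove with ⟨h, -⟩ | ⟨-, hbob⟩
    · exact hgturn h
    obtain ⟨d, hd⟩ := Finset.card_pos.1 hcg
    have reply : ∀ w, g w = none →
        ¬ ((freeColors g).card + 2 ≤ 2 * (untouchedParts (Function.update g w (some d))).card ∨
          2 ≤ (vacantVertices (Function.update g w (some d))).card ∧
          (freeColors g).card + 1 ≤
            2 * (untouchedParts (Function.update g w (some d))).card) := by
      intro w hw hinv'
      have hFd : (freeColors (Function.update g w (some d))).card + 1 = (freeColors g).card := by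
        rw [freeColors_update hw, Finset.card_erase_add_one hd]
      refine ih n (by omega) _ ?_ (by omega)
        (hbob _ ⟨w, d, hw, legalColor_of_mem_freeColors hd w, rfl⟩)
      rw [aliceTurn_iff_even_uncolored hV] at hgturn ⊢
      rw [← card_uncolored_update hw d, Nat.even_add_one, not_not] at hgturn
      exact hgturn
    have waste : 0 < (vacantVertices g).card →
        ¬ ((freeColors g).card + 2 ≤ 2 * (untouchedParts g).card ∨
          3 ≤ (vacantVertices g).card ∧
          (freeColors g).card + 1 ≤ 2 * (untouchedParts g).card) := by
      intro hpos
      obtain ⟨w, hw⟩ := Finset.card_pos.1 hpos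
      obtain ⟨hw, hwU⟩ := (Finset.mem_filter.1 hw).2
      have h := reply w hw
      have hvac := card_vacantVertices_update_of_notMem hw hwU d
      rw [untouchedParts_update, Finset.erase_eq_of_notMem hwU] at h
      omega
    by_cases hvU : v.1 ∈ untouchedParts f
    · have hvac : (vacantVertices g).card + 1 = (vacantVertices f).card + r v.1 :=
        card_vacantVertices_update_of_mem hv hvU c
      have hr := h2 v.1
      have hF : (freeColors g).card + 1 = (freeColors f).card := by
        rw [hFg, Finset.card_erase_add_one (mem_freeColors_of_legalColor hvU hlegal)]
      have := waste (by omega)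
      omega
    · have hvac : (vacantVertices g).card + 1 = (vacantVertices f).card :=
        card_vacantVertices_update_of_notMem hv hvU c
      have hF : (freeColors g).card ≤ (freeColors f).card := by
        rw [hFg]
        exact Finset.card_erase_le
      rw [Finset.erase_eq_of_notMem hvU] at hUg
      by_cases hpos : 0 < (vacantVertices g).card
      · have := waste hpos
        rw [hUg] at this
        omega
      · have hsum := card_uncolored g
        have hodd : ∃ i ∈ untouchedParts g, ¬ Even (r i) := by
          by_contra! hall
          rw [aliceTurn_iff_even_uncolored hV, hsum, Nat.eq_zero_of_not_pos hpos,
            zero_add] at hgturn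
          exact hgturn (Finset.even_sum _ hall)
        obtain ⟨i, hi, hri⟩ := hodd
        have hr : 3 ≤ r i := by
          have := h2 i
          rcases Nat.lt_or_ge 2 (r i) with h | h
          · exact h
          · exact absurd (by rw [show r i = 2 by omega]; exact even_two) hri
        have hw := (Finset.mem_filter.1 hi).2 ⟨0, by omega⟩
        have h := reply _ hw
        have hvac' := card_vacantVertices_update_of_mem hw hi d
        have hU' := Finset.card_erase_add_one hi
        rw [untouchedParts_update] at h
        simp only at h hvac'
        rw [hUg] at h hU'
        omega

end Counting

/-- Alice wins from every position if there are at least as many colors as vertices. -/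
theorem aliceWinsFrom_of_card_le {V C : Type} [Fintype V] [DecidableEq V] [Fintype C]
    [DecidableEq C] (G : SimpleGraph V) (hVC : Fintype.card V ≤ Fintype.card C) (n : ℕ) :
    ∀ f : V → Option C, (uncolored f).card ≤ n → aliceWinsFrom G n f := by
  have hlegal : ∀ (f : V → Option C) (v : V), f v = none → ∃ c, legalColor G f v c := by
    intro f v hv
    by_contra! hno
    simp only [legalColor, not_forall, not_not] at hno
    choose w _ hw using hno
    have hinj : Function.Injective w := fun a b hab => by
      have := hw a
      rw [hab, hw b] at this
      exact (Option.some.inj this).symm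
    have hsurj := (hinj.bijective_of_nat_card_le (by simpa using hVC)).2
    obtain ⟨c, rfl⟩ := hsurj v
    simp [hw c] at hv
  induction n with
  | zero =>
    intro f hf v
    rw [Nat.le_zero, Finset.card_eq_zero] at hf
    by_contra hv
    have : v ∈ uncolored f := by simpa [uncolored] using hv
    simp [hf] at this
  | succ n ih =>
    intro f hf
    have hstep : ∀ f', gameMove G f f' → aliceWinsFrom G n f' := by
      rintro f' ⟨v, c, hv, -, rfl⟩
      have := card_uncolored_update hv c
      exact ih _ (by omega)
    by_cases hfull : isFull f
    · exact Or.inl hfull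
    refine Or.inr ⟨?_, ?_⟩
    · rintro ⟨v, hv, hno⟩
      obtain ⟨c, hc⟩ := hlegal f v hv
      exact hno c hc
    · by_cases hturn : aliceTurn f
      · obtain ⟨v, hv⟩ := not_forall.1 hfull
        have hv : f v = none := by simpa using hv
        obtain ⟨c, hc⟩ := hlegal f v hv
        have hmove : gameMove G f (Function.update f v (some c)) := ⟨v, c, hv, hc, rfl⟩
        exact Or.inl ⟨hturn, _, hmove, hstep _ hmove⟩
      · exact Or.inr ⟨hturn, hstep⟩

theorem exists_aliceWins {V : Type} [Fintype V] [DecidableEq V] (G : SimpleGraph V) :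
    ∃ m, aliceWins G m :=
  ⟨Fintype.card V, aliceWinsFrom_of_card_le G (by simp) _ _ (Finset.card_le_univ _)⟩

theorem game_chromatic_ge_of_three_even (k : ℕ) (hk : 3 ≤ k) (r : Fin k → ℕ)
    (hanti : Antitone r) (h2 : ∀ j, 2 ≤ r j) (h3 : ∃ j, r j = 3)
    (heven : Even (∑ i, r i)) :
    2 * k - 2 ≤ gameChromaticNumber (K k r) := by
  refine le_csInf (exists_aliceWins _) fun m hm => ?_
  by_contra! hlt
  refine not_aliceWinsFrom h2 heven _ _ (by simp [aliceTurn]) (Or.inl ?_) hm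
  simp [freeColors, untouchedParts]
  omega
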